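/- Under the l-th-above-threshold setup, the infimum of Σ_{k≠k*} C_k·|μ_{k*} − μ_k| over all feasible vectors C equals (μ_{k*} − μ_{k'}) / I(μ_{k'}, τ) · 1{k* ≠ K} + (μ_{k*} − μ_{k'−1}) / I(μ_{k'−1}, τ), and this infimum is attained. -/

import Mathlib

/-- Kullback–Leibler divergence between Bernoulli(p) and Bernoulli(q). -/
noncomputable def klBernoulli (p q : ℝ) : ℝ :=
  p * Real.log (p / q) + (1 - p) * Real.log ((1 - p) / (1 - q))

/-- Feasibility in the l-th-above-threshold setup: `C` is nonnegative and satisfies the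
two families of constraints (A) and (B). -/
def FeasibleLth (K kp l kstar : ℕ) (μ : ℕ → ℝ) (τ : ℝ) (C : ℕ → ℝ) : Prop :=
  (∀ k ∈ Finset.Icc 1 K, 0 ≤ C k) ∧
  -- (A): for every m with k' ≤ m ≤ k' + min (l − 2) (K − k* − 1) (as integers; the family
  -- is empty when l = 1 or k* = K) and every strictly increasing tuple (b_{k'},…,b_m)
  -- with b_{k'} > μ_{k'−1} and b_m < τ
  (∀ m : ℕ, kp ≤ m → (m : ℤ) ≤ (kp : ℤ) + min ((l : ℤ) - 2) ((K : ℤ) - (kstar : ℤ) - 1) →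
    ∀ b : ℕ → ℝ, (∀ j, kp ≤ j → j + 1 ≤ m → b j < b (j + 1)) →
      μ (kp - 1) < b kp → b m < τ →
      1 ≤ ∑ j ∈ Finset.Icc kp m, C j * klBernoulli (μ j) (b j)) ∧
  -- (B): for every d ∈ {1,…,k'−2} and every strictly increasing tuple
  -- (b_{k'−d},…,b_{k'−1}) with b_{k'−d} ≥ τ and b_{k'−1} < μ_{k'}
  (∀ d : ℕ, 1 ≤ d → d ≤ kp - 2 →
    ∀ b : ℕ → ℝ, (∀ j, kp - d ≤ j → j + 1 ≤ kp - 1 → b j < b (j + 1)) →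
      τ ≤ b (kp - d) → b (kp - 1) < μ kp →
      1 ≤ ∑ j ∈ Finset.Icc (kp - d) (kp - 1), C j * klBernoulli (μ j) (b j))

theorem klB_mono {p t q : ℝ} (hp : p ∈ Set.Ioo (0 : ℝ) 1) (ht : t ∈ Set.Ioo (0 : ℝ) 1)
    (hq : q ∈ Set.Ioo (0 : ℝ) 1) (h : 0 ≤ (t - q) * (p - t)) :
    klBernoulli p t ≤ klBernoulli p q := by
  obtain ⟨hp0, hp1⟩ := hp
  obtain ⟨ht0, ht1⟩ := ht
  obtain ⟨hq0, hq1⟩ := hq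
  have hp1' : 0 < 1 - p := by linarith
  have ht1' : 0 < 1 - t := by linarith
  have hq1' : 0 < 1 - q := by linarith
  unfold klBernoulli
  have e1 : Real.log (q / t) ≤ q / t - 1 := Real.log_le_sub_one_of_pos (by positivity)
  have e2 : Real.log ((1 - q) / (1 - t)) ≤ (1 - q) / (1 - t) - 1 :=
    Real.log_le_sub_one_of_pos (by positivity)
  rw [Real.log_div hq0.ne' ht0.ne'] at e1
  rw [Real.log_div hq1'.ne' ht1'.ne'] at e2
  rw [Real.log_div hp0.ne' ht0.ne', Real.log_div hp0.ne' hq0.ne',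
    Real.log_div hp1'.ne' ht1'.ne', Real.log_div hp1'.ne' hq1'.ne']
  have f1 := mul_le_mul_of_nonneg_left e1 hp0.le
  have f2 := mul_le_mul_of_nonneg_left e2 hp1'.le
  have key : p * (q / t - 1) + (1 - p) * ((1 - q) / (1 - t) - 1)
      = - ((t - q) * (p - t) / (t * (1 - t))) := by
    field_simp
    ring
  have : 0 ≤ (t - q) * (p - t) / (t * (1 - t)) := by positivity
  nlinarith

theorem klB_pos {p t : ℝ} (hp : p ∈ Set.Ioo (0 : ℝ) 1) (ht : t ∈ Set.Ioo (0 : ℝ) 1)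
    (h : p ≠ t) : 0 < klBernoulli p t := by
  obtain ⟨hp0, hp1⟩ := hp
  obtain ⟨ht0, ht1⟩ := ht
  have hp1' : 0 < 1 - p := by linarith
  have ht1' : 0 < 1 - t := by linarith
  unfold klBernoulli
  have e1 : Real.log (t / p) < t / p - 1 := by
    refine Real.log_lt_sub_one_of_pos (by positivity) ?_
    intro h1
    rw [div_eq_one_iff_eq hp0.ne'] at h1
    exact h h1.symm
  have e2 : Real.log ((1 - t) / (1 - p)) ≤ (1 - t) / (1 - p) - 1 :=
    Real.log_le_sub_one_of_pos (by positivity)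
  rw [Real.log_div ht0.ne' hp0.ne'] at e1
  rw [Real.log_div ht1'.ne' hp1'.ne'] at e2
  rw [Real.log_div hp0.ne' ht0.ne', Real.log_div hp1'.ne' ht1'.ne']
  have f1 := mul_lt_mul_of_pos_left e1 hp0
  have f2 := mul_le_mul_of_nonneg_left e2 hp1'.le
  have k1 : p * (t / p - 1) = t - p := by field_simp
  have k2 : (1 - p) * ((1 - t) / (1 - p) - 1) = p - t := by field_simp; ring
  nlinarith

theorem klB_cont {p t : ℝ} (hp : p ∈ Set.Ioo (0 : ℝ) 1) (ht : t ∈ Set.Ioo (0 : ℝ) 1) :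
    ContinuousAt (fun q => klBernoulli p q) t := by
  obtain ⟨hp0, hp1⟩ := hp
  obtain ⟨ht0, ht1⟩ := ht
  have hp1' : 1 - p ≠ 0 := by linarith
  have ht1' : 1 - t ≠ 0 := by linarith
  have hp0' := hp0.ne'
  have ht0' := ht0.ne'
  unfold klBernoulli
  refine ContinuousAt.add (ContinuousAt.mul continuousAt_const ?_)
    (ContinuousAt.mul continuousAt_const ?_)
  · exact ContinuousAt.log (ContinuousAt.div continuousAt_const continuousAt_id ht0')
      (div_ne_zero hp0' ht0')
  · exact ContinuousAt.log (ContinuousAt.div continuousAt_const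
      (continuousAt_const.sub continuousAt_id) ht1') (div_ne_zero hp1' ht1')

theorem chain_le (b : ℕ → ℝ) (a m : ℕ) (h : a ≤ m)
    (hb : ∀ j, a ≤ j → j + 1 ≤ m → b j < b (j + 1)) : b a ≤ b m := by
  induction m, h using Nat.le_induction with
  | base => exact le_rfl
  | succ n hn ih =>
    exact (ih (fun j h1 h2 => hb j h1 (by omega))).trans (hb n hn le_rfl).le

theorem lthAboveThreshold_inf (K kp l kstar : ℕ) (μ : ℕ → ℝ) (τ : ℝ)
    (hK : 2 ≤ K)
    (hmono : ∀ j k, 1 ≤ j → j < k → k ≤ K → μ j < μ k)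
    (hrange : ∀ k ∈ Finset.Icc 1 K, μ k ∈ Set.Ioo (0 : ℝ) 1)
    (hτ : τ ∈ Set.Ioo (0 : ℝ) 1)
    (hkp : kp ∈ Finset.Icc 3 K)
    (hbelow : μ (kp - 1) < τ) (habove : τ < μ kp)
    (hl : 1 ≤ l) (hkstar : kstar = kp + l - 1) (hkstarK : kstar ≤ K) :
    IsLeast
      {v : ℝ | ∃ C : ℕ → ℝ, FeasibleLth K kp l kstar μ τ C ∧
        v = ∑ k ∈ (Finset.Icc 1 K).erase kstar, C k * |μ kstar - μ k|}
      ((μ kstar - μ kp) / klBernoulli (μ kp) τ * (if kstar ≠ K then (1 : ℝ) else 0)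
        + (μ kstar - μ (kp - 1)) / klBernoulli (μ (kp - 1)) τ) := by
  rw [Finset.mem_Icc] at hkp
  obtain ⟨hkp3, hkpK⟩ := hkp
  have hrP : μ kp ∈ Set.Ioo (0 : ℝ) 1 := hrange kp (Finset.mem_Icc.2 (by omega))
  have hrQ : μ (kp - 1) ∈ Set.Ioo (0 : ℝ) 1 := hrange (kp - 1) (Finset.mem_Icc.2 (by omega))
  have hIP : 0 < klBernoulli (μ kp) τ := klB_pos hrP hτ habove.ne'
  have hIQ : 0 < klBernoulli (μ (kp - 1)) τ := klB_pos hrQ hτ hbelow.ne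
  have hge : μ kp ≤ μ kstar := by
    rcases Nat.lt_or_ge kp kstar with h | h
    · exact (hmono kp kstar (by omega) h hkstarK).le
    · have : kp = kstar := by omega
      rw [this]
  have hPQ : μ (kp - 1) < μ kp := hbelow.trans habove
  have hne : kp - 1 ≠ kp := by omega
  have hsumE : ∀ C : ℕ → ℝ, ∑ k ∈ (Finset.Icc 1 K).erase kstar, C k * |μ kstar - μ k|
      = ∑ k ∈ Finset.Icc 1 K, C k * |μ kstar - μ k| := by
    intro C
    exact Finset.sum_erase _ (by simp)
  have hsub : ({kp - 1, kp} : Finset ℕ) ⊆ Finset.Icc 1 K := by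
    intro x hx
    simp only [Finset.mem_insert, Finset.mem_singleton] at hx
    rw [Finset.mem_Icc]
    omega
  have hpair : ∀ C : ℕ → ℝ, ∑ k ∈ ({kp - 1, kp} : Finset ℕ), C k * |μ kstar - μ k|
      = C (kp - 1) * (μ kstar - μ (kp - 1)) + C kp * (μ kstar - μ kp) := by
    intro C
    rw [Finset.sum_pair hne, abs_of_nonneg (by linarith), abs_of_nonneg (by linarith)]
  constructor
  · let C : ℕ → ℝ := fun k => if k = kp - 1 then 1 / klBernoulli (μ (kp - 1)) τ else
      if k = kp then (if kstar ≠ K then 1 / klBernoulli (μ kp) τ else 0) else 0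
    have hCQ : C (kp - 1) = 1 / klBernoulli (μ (kp - 1)) τ := by simp [C]
    have hCP : C kp = if kstar ≠ K then 1 / klBernoulli (μ kp) τ else 0 := by
      simp only [C]
      rw [if_neg hne.symm, if_pos trivial]
    have hC0 : ∀ k, k ≠ kp - 1 → k ≠ kp → C k = 0 := by
      intro k h1 h2
      simp only [C]
      rw [if_neg h1, if_neg h2]
    refine ⟨C, ⟨?_, ?_, ?_⟩, ?_⟩
    · intro k _
      simp only [C]
      split_ifs <;> positivity
    · intro m hm hm2 b hb hb1 hb2
      have hKs : kstar ≠ K := by omega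
      rw [Finset.sum_eq_single kp]
      · rw [hCP, if_pos hKs, one_div, ← div_eq_inv_mul, one_le_div hIP]
        have := chain_le b kp m hm hb
        exact klB_mono hrP hτ ⟨hrQ.1.trans hb1, by linarith [hτ.2]⟩
          (mul_nonneg (by linarith) (by linarith))
      · intro j hj hj2
        rw [Finset.mem_Icc] at hj
        rw [hC0 j (by omega) hj2, zero_mul]
      · intro h
        exact absurd (Finset.mem_Icc.2 ⟨le_rfl, hm⟩) h
    · intro d hd hd2 b hb hb1 hb2
      rw [Finset.sum_eq_single (kp - 1)]
      · rw [hCQ, one_div, ← div_eq_inv_mul, one_le_div hIQ]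
        have := chain_le b (kp - d) (kp - 1) (by omega) hb
        exact klB_mono hrQ hτ ⟨by linarith [hτ.1], by linarith [hrP.2]⟩
          (mul_nonneg_of_nonpos_of_nonpos (by linarith) (by linarith))
      · intro j hj hj2
        rw [Finset.mem_Icc] at hj
        rw [hC0 j hj2 (by omega), zero_mul]
      · intro h
        exact absurd (Finset.mem_Icc.2 ⟨by omega, le_rfl⟩) h
    · rw [hsumE, ← Finset.sum_subset hsub, hpair, hCQ, hCP]
      · split_ifs <;> ring
      · intro x _ hx
        simp only [Finset.mem_insert, Finset.mem_singleton, not_or] at hx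
        rw [hC0 x hx.1 hx.2, zero_mul]
  · rintro v ⟨C, ⟨hC, hA, hB⟩, rfl⟩
    have hCP0 : 0 ≤ C kp := hC kp (Finset.mem_Icc.2 (by omega))
    have hQ : 1 / klBernoulli (μ (kp - 1)) τ ≤ C (kp - 1) := by
      have := hB 1 le_rfl (by omega) (fun _ => τ) (fun j h1 h2 => by omega) le_rfl habove
      rw [Finset.Icc_self, Finset.sum_singleton] at this
      rwa [div_le_iff₀ hIQ]
    have hP : (μ kstar - μ kp) / klBernoulli (μ kp) τ * (if kstar ≠ K then (1 : ℝ) else 0)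
        ≤ C kp * (μ kstar - μ kp) := by
      by_cases hKs : kstar = K
      · rw [if_neg (not_not.2 hKs), mul_zero]
        exact mul_nonneg hCP0 (by linarith)
      · rw [if_pos hKs, mul_one]
        by_cases hl1 : l = 1
        · have : kstar = kp := by omega
          rw [this]; simp
        · have hlim : 1 ≤ C kp * klBernoulli (μ kp) τ := by
            have ht : Filter.Tendsto (fun q => C kp * klBernoulli (μ kp) q)
                (nhdsWithin τ (Set.Iio τ)) (nhds (C kp * klBernoulli (μ kp) τ)) :=
              ((continuousAt_const.mul (klB_cont hrP hτ)).tendsto).mono_left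
                nhdsWithin_le_nhds
            refine ge_of_tendsto ht ?_
            filter_upwards [Ioo_mem_nhdsLT hbelow] with q hq
            have := hA kp le_rfl (by omega) (fun _ => q) (fun j h1 h2 => by omega) hq.1 hq.2
            rwa [Finset.Icc_self, Finset.sum_singleton] at this
          rw [div_le_iff₀ hIP]
          nlinarith
    have hQ' := mul_le_mul_of_nonneg_right hQ (show 0 ≤ μ kstar - μ (kp - 1) by linarith)
    have hle := Finset.sum_le_sum_of_subset_of_nonneg
      (f := fun k => C k * |μ kstar - μ k|) hsub
      (fun i hi _ => mul_nonneg (hC i hi) (abs_nonneg _))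
    rw [hpair] at hle
    rw [hsumE]
    rw [one_div, ← div_eq_inv_mul] at hQ'
    linarith
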